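/- arXiv:0809.3353 — 2 statements merged into one kernel-verified Lean document; each statement's English description precedes it below -/
import Mathlib

section
/- Let R be a Cohen-Macaulay local ring of dimension d with canonical module ω, M a maximal Cohen-Macaulay R-module, and J = (x₁,…,x_d) a parameter ideal. Then for all n ≥ 0, ℓ(Hom_R(M, ω/J^{n+1}ω)) = ℓ(M/JM)·C(n+d, d), where C(n+d,d) is the binomial coefficient. -/
open CategoryTheory IsLocalRing

/-- `Ext^i_R(M,N)` as an object of `ModuleCat R`. -/
noncomputable abbrev ExtM (R : Type) [CommRing R] (i : ℕ) (M N : Type) [AddCommGroup M]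
    [Module R M] [AddCommGroup N] [Module R N] : ModuleCat R :=
  ((Ext R (ModuleCat R) i).obj (Opposite.op (ModuleCat.of R M))).obj (ModuleCat.of R N)

/-- The length of an `R`-module, as the Krull dimension of its lattice of submodules. -/
noncomputable abbrev len (R M : Type) [CommRing R] [AddCommGroup M] [Module R M] : WithBot ℕ∞ :=
  Order.krullDim (Submodule R M)

/-- `M` is a maximal Cohen-Macaulay `R`-module: it admits a regular sequence, contained in
the maximal ideal, of length `dim R`. -/
def IsMCM (R : Type) [CommRing R] [IsLocalRing R] (M : Type) [AddCommGroup M]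
    [Module R M] : Prop :=
  ∃ rs : List R, (∀ x ∈ rs, x ∈ maximalIdeal R) ∧
    (rs.length : WithBot ℕ∞) = ringKrullDim R ∧ RingTheory.Sequence.IsRegular M rs

/-- The local ring `R` is Cohen-Macaulay. -/
def IsCMLocalRing (R : Type) [CommRing R] [IsLocalRing R] : Prop := IsMCM R R

/-- `ω` is a canonical module of the local ring `R` of dimension `d`:
it is finitely generated, `Ext^d(k,ω) ≅ k` and `Ext^i(k,ω) = 0` for `i ≠ d`. -/
def IsCanonicalModule (R : Type) [CommRing R] [IsLocalRing R] (d : ℕ)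
    (ω : Type) [AddCommGroup ω] [Module R ω] : Prop :=
  Module.Finite R ω ∧
  Nonempty ((ExtM R d (ResidueField R) ω) ≃ₗ[R] ResidueField R) ∧
  ∀ i : ℕ, i ≠ d → Subsingleton (ExtM R i (ResidueField R) ω)

universe u

namespace CategoryTheory.ProjectiveResolution

variable {R : Type u} [CommRing R] {X : ModuleCat.{u} R} (P : ProjectiveResolution X)

/-- The degree `n` cocycles of `Hom(P, Y)` for a projective resolution `P`. -/
noncomputable def homCocycles (Y : ModuleCat.{u} R) (n : ℕ) :
    Submodule R (P.complex.X n ⟶ Y) :=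
  LinearMap.ker (Linear.leftComp R Y (P.complex.d (n + 1) n))

lemma comp_eq_zero_of_mem_homCocycles {Y : ModuleCat.{u} R} {n : ℕ} (f : P.homCocycles Y n) :
    P.complex.d (n + 1) n ≫ f.1 = 0 :=
  f.2

/-- The class in `Ext` of a cocycle, as a linear map. -/
noncomputable def extMkLinear (Y : ModuleCat.{u} R) (n : ℕ) :
    P.homCocycles Y n →ₗ[R] Abelian.Ext X Y n where
  toFun f := P.extMk f.1 (n + 1) rfl (P.comp_eq_zero_of_mem_homCocycles f)
  map_add' f g := by
    rw [P.add_extMk]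
    rfl
  map_smul' r f := by
    rw [RingHom.id_apply, Abelian.Ext.smul_eq_comp_mk₀, P.extMk_comp_mk₀]
    simp

lemma extMkLinear_surjective (Y : ModuleCat.{u} R) (n : ℕ) :
    Function.Surjective (P.extMkLinear Y n) := by
  intro α
  obtain ⟨f, hf, h⟩ := P.extMk_surjective α (n + 1) rfl
  exact ⟨⟨f, hf⟩, h⟩

lemma extMk_zero_eq_zero_iff {Y : ModuleCat.{u} R} (f : P.complex.X 0 ⟶ Y)
    (hf : P.complex.d 1 0 ≫ f = 0) : P.extMk f 1 rfl hf = 0 ↔ f = 0 := by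
  simp only [← P.extEquivCohomologyClass.apply_eq_iff_eq,
    extEquivCohomologyClass_extMk, extEquivCohomologyClass_zero,
    CochainComplex.HomComplex.CohomologyClass.mk_eq_zero_iff]
  rw [CochainComplex.HomComplex.Cocycle.toSingleMk_mem_coboundaries_iff _ _ _ _ _ 1 (by simp)]
  have hz : P.cochainComplex.d (-((0 : ℕ) : ℤ)) 1 = 0 :=
    (P.cochainComplex.isZero_of_isStrictlyLE 0 1 (by lia)).eq_of_tgt _ _
  rw [hz]
  constructor
  · rintro ⟨g, hg⟩
    rw [Limits.zero_comp] at hg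
    rw [← cancel_epi (P.cochainComplexXIso (-((0 : ℕ) : ℤ)) 0 rfl).hom, ← hg]
    simp
  · rintro rfl
    exact ⟨0, by simp⟩

lemma mem_ker_extMkLinear_iff {Y : ModuleCat.{u} R} {n : ℕ} (f : P.homCocycles Y n) :
    f ∈ LinearMap.ker (P.extMkLinear Y n) ↔
      ∃ g : P.complex.X ((ComplexShape.up ℕ).prev n) ⟶ Y,
        P.complex.d n ((ComplexShape.up ℕ).prev n) ≫ g = f.1 := by
  cases n with
  | zero =>
    refine (P.extMk_zero_eq_zero_iff f.1 f.2).trans ?_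
    simp [eq_comm]
  | succ n =>
    rw [CochainComplex.prev_nat_succ]
    exact P.extMk_eq_zero_iff f.1 (n + 2) rfl f.2 n rfl

include P in
/-- `Ext` defined through the derived category agrees with the left derived functor. -/
theorem nonempty_ext_linearEquiv (Y : ModuleCat.{u} R) (n : ℕ) :
    Nonempty (Abelian.Ext X Y n ≃ₗ[R] ((Ext R (ModuleCat.{u} R) n).obj (Opposite.op X)).obj Y) := by
  set K := ChainComplex.linearYonedaObj P.complex R Y
  let S := K.sc n
  let e₁ := (P.isoExt (R := R) n Y ≪≫ S.moduleCatHomologyIso).toLinearEquiv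
  have hker : LinearMap.ker S.g.hom = P.homCocycles Y n := by
    ext f
    change P.complex.d ((ComplexShape.up ℕ).next n) n ≫ f = 0 ↔ P.complex.d (n + 1) n ≫ f = 0
    rw [CochainComplex.next]
  let e₂ : LinearMap.ker S.g.hom ≃ₗ[R] P.homCocycles Y n := LinearEquiv.ofEq _ _ hker
  let φ : LinearMap.ker S.g.hom →ₗ[R] Abelian.Ext X Y n := P.extMkLinear Y n ∘ₗ e₂.toLinearMap
  have hφ : Function.Surjective φ := (P.extMkLinear_surjective Y n).comp e₂.surjective
  have hk : LinearMap.ker φ = LinearMap.range S.moduleCatToCycles := by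
    ext f
    refine (P.mem_ker_extMkLinear_iff (e₂ f)).trans ?_
    constructor
    · rintro ⟨g, hg⟩
      exact ⟨g, Subtype.ext hg⟩
    · rintro ⟨g, hg⟩
      exact ⟨g, congrArg Subtype.val hg⟩
  exact ⟨(φ.quotKerEquivOfSurjective hφ).symm ≪≫ₗ Submodule.quotEquivOfEq _ _ hk ≪≫ₗ e₁.symm⟩

end CategoryTheory.ProjectiveResolution

section LongExactSequences

open Abelian

variable {R : Type u} [CommRing R]

/-- The `Ext`-module of two modules, computed in `ModuleCat R`. -/
abbrev ModExt (R : Type u) [CommRing R] (M N : Type u) [AddCommGroup M] [Module R M]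
    [AddCommGroup N] [Module R N] (i : ℕ) : Type u :=
  Abelian.Ext (ModuleCat.of R M) (ModuleCat.of R N) i

variable {A B C N : Type u} [AddCommGroup A] [Module R A] [AddCommGroup B] [Module R B]
  [AddCommGroup C] [Module R C] [AddCommGroup N] [Module R N]
  {f : A →ₗ[R] B} {g : B →ₗ[R] C}

lemma ModuleCat.shortExact_of_exact (hf : Function.Injective f) (hg : Function.Surjective g)
    (h : Function.Exact f g) :
    (ModuleCat.shortComplexOfCompEqZero f g h.linearMap_comp_eq_zero).ShortExact where
  exact := (ShortComplex.ShortExact.moduleCat_exact_iff_function_exact _).mpr h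
  mono_f := (ModuleCat.mono_iff_injective _).mpr hf
  epi_g := (ModuleCat.epi_iff_surjective _).mpr hg

namespace ModExt

/-- Precomposition with a linear map. -/
noncomputable abbrev precomp (f : A →ₗ[R] B) (N : Type u) [AddCommGroup N] [Module R N] (i : ℕ) :
    ModExt R B N i →ₗ[R] ModExt R A N i :=
  (Ext.mk₀ (ModuleCat.ofHom f)).precompOfLinear R (ModuleCat.of R N) (zero_add i)

/-- Postcomposition with a linear map. -/
noncomputable abbrev postcomp (f : A →ₗ[R] B) (N : Type u) [AddCommGroup N] [Module R N] (i : ℕ) :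
    ModExt R N A i →ₗ[R] ModExt R N B i :=
  (Ext.mk₀ (ModuleCat.ofHom f)).postcompOfLinear R (ModuleCat.of R N) (add_zero i)

lemma precomp_lsmul (y : R) (i : ℕ) (z : ModExt R A N i) :
    precomp (LinearMap.lsmul R A y) N i z = y • z := by
  have : ModuleCat.ofHom (LinearMap.lsmul R A y) = y • 𝟙 (ModuleCat.of R A) := by
    ext
    rfl
  simp [this, Ext.mk₀_smul]

lemma postcomp_lsmul (y : R) (i : ℕ) (z : ModExt R N A i) :
    postcomp (LinearMap.lsmul R A y) N i z = y • z := by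
  have : ModuleCat.ofHom (LinearMap.lsmul R A y) = y • 𝟙 (ModuleCat.of R A) := by
    ext
    rfl
  simp [this, Ext.mk₀_smul]

lemma smul_eq_zero_of_mem_annihilator {y : R} (hy : y ∈ Module.annihilator R A) (i : ℕ)
    (z : ModExt R A N i) : y • z = 0 := by
  have : LinearMap.lsmul R A y = 0 := by
    ext a
    exact Module.mem_annihilator.mp hy a
  rw [← precomp_lsmul, this]
  change (Ext.mk₀ (0 : ModuleCat.of R A ⟶ ModuleCat.of R A)).comp z (zero_add i) = 0
  simp

/-- `Ext` is invariant under isomorphism in the first variable. -/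
noncomputable def precompEquiv (e : A ≃ₗ[R] B) (N : Type u) [AddCommGroup N] [Module R N] (i : ℕ) :
    ModExt R B N i ≃ₗ[R] ModExt R A N i :=
  LinearEquiv.ofLinearMap (precomp e.toLinearMap N i) (precomp e.symm.toLinearMap N i)
    (LinearMap.ext fun z ↦ by simp [← ModuleCat.ofHom_comp])
    (LinearMap.ext fun z ↦ by simp [← ModuleCat.ofHom_comp])

/-- `Ext` is invariant under isomorphism in the second variable. -/
noncomputable def postcompEquiv (e : A ≃ₗ[R] B) (N : Type u) [AddCommGroup N] [Module R N] (i : ℕ) :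
    ModExt R N A i ≃ₗ[R] ModExt R N B i :=
  LinearEquiv.ofLinearMap (postcomp e.toLinearMap N i) (postcomp e.symm.toLinearMap N i)
    (LinearMap.ext fun z ↦ by simp [← ModuleCat.ofHom_comp])
    (LinearMap.ext fun z ↦ by simp [← ModuleCat.ofHom_comp])

/-- In degree zero `Ext` is the module of linear maps. -/
noncomputable def equivHom (A N : Type u) [AddCommGroup A] [Module R A] [AddCommGroup N]
    [Module R N] : ModExt R A N 0 ≃ₗ[R] (A →ₗ[R] N) :=
  Ext.linearEquiv₀.trans ModuleCat.homLinearEquiv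

lemma subsingleton_of_subsingleton_left [Subsingleton A] (i : ℕ) :
    Subsingleton (ModExt R A N i) :=
  subsingleton_of_forall_eq 0 fun z ↦ by
    rw [← one_smul R z]
    exact smul_eq_zero_of_mem_annihilator
      (Module.mem_annihilator.mpr fun _ ↦ Subsingleton.elim _ _) i z

lemma subsingleton_of_subsingleton_right [Subsingleton A] (i : ℕ) :
    Subsingleton (ModExt R N A i) :=
  subsingleton_of_forall_eq 0 fun z ↦ by
    rw [← z.comp_mk₀_id, (ModuleCat.isZero_of_subsingleton (ModuleCat.of R A)).eq_of_src (𝟙 _) 0,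
      Ext.mk₀_zero, Ext.comp_zero]

section LES

variable (hf : Function.Injective f) (hg : Function.Surjective g) (h : Function.Exact f g)
include hf hg h

lemma exact_precomp (N : Type u) [AddCommGroup N] [Module R N] (i : ℕ) :
    Function.Exact (precomp g N i) (precomp f N i) := by
  have hS := ModuleCat.shortExact_of_exact hf hg h
  have := Ext.contravariant_sequence_exact₂' hS (ModuleCat.of R N) i
  rw [ShortComplex.ab_exact_iff_function_exact] at this
  exact this

lemma exact_postcomp (N : Type u) [AddCommGroup N] [Module R N] (i : ℕ) :
    Function.Exact (postcomp f N i) (postcomp g N i) := by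
  have hS := ModuleCat.shortExact_of_exact hf hg h
  have := Ext.covariant_sequence_exact₂' (ModuleCat.of R N) hS i
  rw [ShortComplex.ab_exact_iff_function_exact] at this
  exact this

lemma precomp_surjective (i : ℕ) [Subsingleton (ModExt R C N (i + 1))] :
    Function.Surjective (precomp f N i) := fun z ↦
  Ext.contravariant_sequence_exact₁ (ModuleCat.shortExact_of_exact hf hg h) _ z (add_comm 1 i)
    (Subsingleton.elim (α := ModExt R C N (i + 1)) _ _)

lemma postcomp_surjective (i : ℕ) [Subsingleton (ModExt R N A (i + 1))] :
    Function.Surjective (postcomp g N i) := fun z ↦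
  Ext.covariant_sequence_exact₃ _ (ModuleCat.shortExact_of_exact hf hg h) z rfl
    (Subsingleton.elim (α := ModExt R N A (i + 1)) _ _)

omit hf h in
lemma precomp_zero_injective : Function.Injective (precomp g N 0) :=
  have : Epi (ModuleCat.ofHom g) := (ModuleCat.epi_iff_surjective _).mpr hg
  Ext.precomp_mk₀_injective_of_epi _ _

omit hg h in
lemma postcomp_zero_injective : Function.Injective (postcomp f N 0) :=
  have : Mono (ModuleCat.ofHom f) := (ModuleCat.mono_iff_injective _).mpr hf
  Ext.postcomp_mk₀_injective_of_mono _ _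

lemma precomp_succ_injective (i : ℕ) [Subsingleton (ModExt R A N i)] :
    Function.Injective (precomp g N (i + 1)) := by
  rw [injective_iff_map_eq_zero]
  intro z hz
  obtain ⟨w, rfl⟩ := Ext.contravariant_sequence_exact₃ (ModuleCat.shortExact_of_exact hf hg h) _ z
    hz (add_comm 1 i)
  rw [Subsingleton.elim (α := ModExt R A N i) w 0]
  exact Ext.comp_zero ..

lemma subsingleton_precomp_middle (i : ℕ) [Subsingleton (ModExt R A N i)]
    [Subsingleton (ModExt R C N i)] : Subsingleton (ModExt R B N i) := by
  refine subsingleton_of_forall_eq 0 fun z ↦ ?_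
  obtain ⟨w, rfl⟩ := (exact_precomp hf hg h N i z).mp (Subsingleton.elim _ _)
  rw [Subsingleton.elim w 0, map_zero]

lemma subsingleton_postcomp_middle (i : ℕ) [Subsingleton (ModExt R N A i)]
    [Subsingleton (ModExt R N C i)] : Subsingleton (ModExt R N B i) := by
  refine subsingleton_of_forall_eq 0 fun z ↦ ?_
  obtain ⟨w, rfl⟩ := (exact_postcomp hf hg h N i z).mp (Subsingleton.elim _ _)
  rw [Subsingleton.elim w 0, map_zero]

lemma subsingleton_postcomp_right (i : ℕ) [Subsingleton (ModExt R N B i)]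
    [Subsingleton (ModExt R N A (i + 1))] : Subsingleton (ModExt R N C i) :=
  (postcomp_surjective hf hg h i).subsingleton

lemma length_precomp_middle (i : ℕ) (hi : ∀ j, j + 1 = i → Subsingleton (ModExt R A N j))
    [Subsingleton (ModExt R C N (i + 1))] :
    Module.length R (ModExt R B N i) =
      Module.length R (ModExt R C N i) + Module.length R (ModExt R A N i) := by
  refine Module.length_eq_add_of_exact (precomp g N i) (precomp f N i) ?_
    (precomp_surjective hf hg h i) (exact_precomp hf hg h N i)
  cases i with
  | zero => exact precomp_zero_injective hg
  | succ j =>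
    have := hi j rfl
    exact precomp_succ_injective hf hg h j

lemma length_postcomp_middle [Subsingleton (ModExt R N A 1)] :
    Module.length R (ModExt R N B 0) =
      Module.length R (ModExt R N A 0) + Module.length R (ModExt R N C 0) :=
  Module.length_eq_add_of_exact (postcomp f N 0) (postcomp g N 0)
    (postcomp_zero_injective hf) (postcomp_surjective hf hg h 0) (exact_postcomp hf hg h N 0)

/-- If `Ext i N B = 0` and `A → B` induces zero on `Ext (i + 1) N`, then the connecting map
is an isomorphism. -/
lemma length_postcomp_shift (i : ℕ) [Subsingleton (ModExt R N B i)]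
    (h0 : ∀ z, postcomp f N (i + 1) z = 0) :
    Module.length R (ModExt R N C i) = Module.length R (ModExt R N A (i + 1)) := by
  have hS := ModuleCat.shortExact_of_exact hf hg h
  let δ : ModExt R N C i →ₗ[R] ModExt R N A (i + 1) :=
    hS.extClass.postcompOfLinear R (ModuleCat.of R N) rfl
  refine (LinearEquiv.ofBijective δ ⟨?_, fun z ↦ ?_⟩).length_eq
  · rw [injective_iff_map_eq_zero]
    intro z hz
    obtain ⟨w, rfl⟩ := Ext.covariant_sequence_exact₃ _ hS z rfl hz
    rw [Subsingleton.elim (α := ModExt R N B i) w 0]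
    exact Ext.zero_comp ..
  · exact Ext.covariant_sequence_exact₁ _ hS z (h0 z) rfl

end LES

lemma subsingleton_of_smul_surjective [IsLocalRing R] [IsNoetherianRing R] [Module.Finite R A]
    [Module.Finite R N] (i : ℕ) {y : R} (hy : y ∈ maximalIdeal R)
    (hs : ∀ z : ModExt R A N i, ∃ w, y • w = z) : Subsingleton (ModExt R A N i) := by
  have htop : (⊤ : Submodule R (ModExt R A N i)) ≤ Ideal.span {y} • ⊤ := by
    intro z _
    obtain ⟨w, rfl⟩ := hs z
    exact Submodule.smul_mem_smul (Ideal.mem_span_singleton_self y) Submodule.mem_top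
  have hbot := Submodule.eq_bot_of_le_smul_of_le_jacobson_bot _ _ Module.Finite.fg_top htop
    (by rwa [jacobson_eq_maximalIdeal ⊥ bot_ne_top, Ideal.span_singleton_le_iff_mem])
  exact (Submodule.subsingleton_iff R).mp (subsingleton_of_bot_eq_top hbot.symm)

/-- If multiplication by `y ∈ 𝔪` on `A` is injective with cokernel `C`, vanishing of
`Ext (i + 1) C N` forces vanishing of `Ext i A N`. -/
lemma subsingleton_of_lsmul_exact [IsLocalRing R] [IsNoetherianRing R] [Module.Finite R A]
    [Module.Finite R N] (i : ℕ) {y : R} (hy : y ∈ maximalIdeal R) {g : A →ₗ[R] C}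
    (hf : Function.Injective (LinearMap.lsmul R A y)) (hg : Function.Surjective g)
    (h : Function.Exact (LinearMap.lsmul R A y) g) [Subsingleton (ModExt R C N (i + 1))] :
    Subsingleton (ModExt R A N i) := by
  refine subsingleton_of_smul_surjective i hy fun z ↦ ?_
  obtain ⟨w, rfl⟩ := precomp_surjective hf hg h i z
  exact ⟨w, (precomp_lsmul y i w).symm⟩

end ModExt

end LongExactSequences

section Vanishing

open RingTheory.Sequence ModExt
open scoped Pointwise

variable {R : Type u} [CommRing R]

lemma exact_lsmul_mkQ (A : Type u) [AddCommGroup A] [Module R A] (y : R) :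
    Function.Exact (LinearMap.lsmul R A y) (y • (⊤ : Submodule R A)).mkQ := by
  intro a
  rw [← LinearMap.mem_ker, Submodule.ker_mkQ, Submodule.mem_smul_pointwise_iff_exists]
  simp

lemma sup_span_singleton_le_annihilator_quotSMulTop {A : Type u} [AddCommGroup A] [Module R A]
    {I : Ideal R} (hI : I ≤ Module.annihilator R A) (y : R) :
    I ⊔ Ideal.span {y} ≤ Module.annihilator R (QuotSMulTop y A) := by
  rw [sup_le_iff, Ideal.span_singleton_le_iff_mem]
  exact ⟨hI.trans (LinearMap.annihilator_le_of_surjective _ (Submodule.mkQ_surjective _)),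
    QuotSMulTop.mem_annihilator _ _⟩

lemma isSMulRegular_quotient_of_notMem {p : Ideal R} (hp : p.IsPrime) {y : R} (hy : y ∉ p) :
    IsSMulRegular (R ⧸ p) y := by
  rw [isSMulRegular_iff_right_eq_zero_of_smul]
  intro a ha
  obtain ⟨a, rfl⟩ := Ideal.Quotient.mk_surjective a
  rw [Algebra.smul_def, Ideal.Quotient.algebraMap_eq, ← map_mul,
    Ideal.Quotient.eq_zero_iff_mem] at ha
  exact Ideal.Quotient.eq_zero_iff_mem.mpr ((hp.mem_or_mem ha).resolve_left hy)

lemma le_annihilator_quotient (p : Ideal R) : p ≤ Module.annihilator R (R ⧸ p) :=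
  (Ideal.annihilator_quotient (I := p)).ge

variable [IsNoetherianRing R] {N : Type u} [AddCommGroup N] [Module R N]

/-- Vanishing of `Ext i L N` for `L` annihilated by `I` can be tested on cyclic modules `R ⧸ p`
with `p` a prime containing `I`. -/
lemma ModExt.subsingleton_of_forall_prime {I : Ideal R} {i : ℕ}
    (hp : ∀ p : Ideal R, p.IsPrime → I ≤ p → Subsingleton (ModExt R (R ⧸ p) N i))
    (L : Type u) [AddCommGroup L] [Module R L] [hL : Module.Finite R L]
    (hI : I ≤ Module.annihilator R L) : Subsingleton (ModExt R L N i) := by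
  induction hL using IsNoetherianRing.induction_on_isQuotientEquivQuotientPrime R with
  | subsingleton L => exact subsingleton_of_subsingleton_left i
  | quotient L p e =>
    rw [e.annihilator_eq, Ideal.annihilator_quotient] at hI
    have := hp p.1 p.2 hI
    exact (precompEquiv e N i).symm.subsingleton
  | exact A B C f g hf hg h hA hC =>
    have := hA (hI.trans (f.annihilator_le_of_injective hf))
    have := hC (hI.trans (g.annihilator_le_of_surjective hg))
    exact subsingleton_precomp_middle hf hg h i

variable [IsLocalRing R]

omit [IsNoetherianRing R] in
lemma eq_maximalIdeal_of_pow_le {p : Ideal R} (hp : p.IsPrime) {k : ℕ}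
    (h : maximalIdeal R ^ k ≤ p) : p = maximalIdeal R :=
  le_antisymm (le_maximalIdeal hp.ne_top) (hp.le_of_pow_le h)

lemma ModExt.subsingleton_of_maximalIdeal_pow_le {i k : ℕ}
    [hk : Subsingleton (ModExt R (ResidueField R) N i)]
    (L : Type u) [AddCommGroup L] [Module R L] [Module.Finite R L]
    (hL : maximalIdeal R ^ k ≤ Module.annihilator R L) : Subsingleton (ModExt R L N i) := by
  refine subsingleton_of_forall_prime (fun p hp h ↦ ?_) L hL
  rw [eq_maximalIdeal_of_pow_le hp h]
  exact hk

/-- If `Ext d k N ≃ k` and the neighbouring `Ext`s of `k` vanish, then `Ext d (-) N` preserves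
length on modules of finite length. -/
lemma ModExt.length_of_maximalIdeal_pow_le {d k : ℕ}
    (hlt : ∀ j, j + 1 = d → Subsingleton (ModExt R (ResidueField R) N j))
    [Subsingleton (ModExt R (ResidueField R) N (d + 1))]
    (e₀ : ModExt R (ResidueField R) N d ≃ₗ[R] ResidueField R)
    (L : Type u) [AddCommGroup L] [Module R L] [hL : Module.Finite R L]
    (hk : maximalIdeal R ^ k ≤ Module.annihilator R L) :
    Module.length R (ModExt R L N d) = Module.length R L := by
  induction hL using IsNoetherianRing.induction_on_isQuotientEquivQuotientPrime R with
  | subsingleton L =>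
    have := subsingleton_of_subsingleton_left (R := R) (A := L) (N := N) d
    rw [Module.length_eq_zero, Module.length_eq_zero]
  | quotient L p e =>
    rw [e.annihilator_eq, Ideal.annihilator_quotient] at hk
    rw [eq_maximalIdeal_of_pow_le p.2 hk] at e
    exact ((precompEquiv e N d).symm ≪≫ₗ e₀ ≪≫ₗ e.symm).length_eq
  | exact A B C f g hf hg h hA hC =>
    have hkA := hk.trans (f.annihilator_le_of_injective hf)
    have hkC := hk.trans (g.annihilator_le_of_surjective hg)
    have := subsingleton_of_maximalIdeal_pow_le (N := N) (i := d + 1) C hkC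
    rw [length_precomp_middle hf hg h d fun j hj ↦
        have := hlt j hj
        subsingleton_of_maximalIdeal_pow_le A hkA,
      hA hkA, hC hkC, add_comm, Module.length_eq_add_of_exact f g hf hg h]

variable [Module.Finite R N]

lemma ModExt.subsingleton_of_quotSMulTop {A : Type u} [AddCommGroup A] [Module R A]
    [Module.Finite R A] {y : R} (hy : y ∈ maximalIdeal R) (hreg : IsSMulRegular A y) (i : ℕ)
    [Subsingleton (ModExt R (QuotSMulTop y A) N (i + 1))] : Subsingleton (ModExt R A N i) :=
  subsingleton_of_lsmul_exact i hy hreg (Submodule.mkQ_surjective _) (exact_lsmul_mkQ A y)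

/-- Ischebeck's vanishing: if `L` becomes of finite length modulo `r` elements, then `Ext i L N`
vanishes as soon as `Ext j k N` does for all `j ≤ i + r`. -/
lemma ModExt.subsingleton_of_maximalIdeal_pow_le_sup {k : ℕ} (ys : List R)
    (hys : ∀ y ∈ ys, y ∈ maximalIdeal R) (I : Ideal R)
    (hI : maximalIdeal R ^ k ≤ I ⊔ Ideal.ofList ys) (i : ℕ)
    (hk : ∀ j ≤ i + ys.length, Subsingleton (ModExt R (ResidueField R) N j))
    (L : Type u) [AddCommGroup L] [Module R L] [Module.Finite R L]
    (hL : I ≤ Module.annihilator R L) : Subsingleton (ModExt R L N i) := by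
  induction ys generalizing I i L with
  | nil =>
    have := hk i le_self_add
    rw [Ideal.ofList_nil, sup_bot_eq] at hI
    exact subsingleton_of_maximalIdeal_pow_le L (hI.trans hL)
  | cons y ys ih =>
    rw [List.forall_mem_cons] at hys
    rw [List.length_cons] at hk
    refine subsingleton_of_forall_prime (fun p hp hIp ↦ ?_) L hL
    rw [Ideal.ofList_cons, ← sup_assoc] at hI
    by_cases hy : y ∈ p
    · refine ih hys.2 p (hI.trans (sup_le_sup_right (sup_le hIp ?_) _)) i
        (fun j hj ↦ hk j (by lia)) _ (le_annihilator_quotient p)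
      rwa [Ideal.span_singleton_le_iff_mem]
    · have := ih hys.2 (p ⊔ Ideal.span {y}) (hI.trans (by gcongr)) (i + 1)
        (fun j hj ↦ hk j (by lia)) (QuotSMulTop y (R ⧸ p))
        (sup_span_singleton_le_annihilator_quotSMulTop (le_annihilator_quotient p) y)
      exact subsingleton_of_quotSMulTop hys.1 (isSMulRegular_quotient_of_notMem hp hy) i

/-- A module of depth at least `r` is regular for any `r` elements cutting its support down
to the closed point. -/
lemma isWeaklyRegular_of_ext_residueField {k : ℕ} (ys : List R)
    (hys : ∀ y ∈ ys, y ∈ maximalIdeal R) (I : Ideal R)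
    (hI : maximalIdeal R ^ k ≤ I ⊔ Ideal.ofList ys)
    (hk : ∀ j < ys.length, Subsingleton (ModExt R (ResidueField R) N j))
    (hN : I ≤ Module.annihilator R N) : IsWeaklyRegular N ys := by
  induction ys generalizing I N with
  | nil => exact .nil _ _
  | cons y ys ih =>
    rw [List.forall_mem_cons] at hys
    rw [List.length_cons] at hk
    rw [Ideal.ofList_cons, ← sup_assoc] at hI
    have hreg : IsSMulRegular N y := by
      by_contra hy
      rw [← Set.mem_ofPred_eq (p := IsSMulRegular N), ← Set.mem_compl_iff,
        ← biUnion_associatedPrimes_eq_compl_regular, Set.mem_iUnion₂] at hy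
      obtain ⟨p, hpN, hyp⟩ := hy
      have hIp : I ≤ p := by
        have := IsAssociatedPrime.annihilator_le hpN
        rw [Submodule.annihilator_top] at this
        exact hN.trans this
      obtain ⟨hp, f, hf⟩ := (isAssociatedPrime_iff_exists_injective_linearMap _ _).mp hpN
      have hsub : Subsingleton (ModExt R (R ⧸ p) N 0) := by
        refine subsingleton_of_maximalIdeal_pow_le_sup ys hys.2 p
          (hI.trans (sup_le_sup_right (sup_le hIp ?_) _)) 0 (fun j hj ↦ hk j (by lia)) _
          (le_annihilator_quotient p)
        rwa [Ideal.span_singleton_le_iff_mem]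
      have := (equivHom (R := R) (R ⧸ p) N).symm.subsingleton
      have := Ideal.Quotient.nontrivial_iff.mpr hp.ne_top
      refine one_ne_zero (α := R ⧸ p) (hf ?_)
      rw [Subsingleton.elim f 0]
      rfl
    refine .cons hreg (ih hys.2 (I ⊔ Ideal.span {y}) hI (fun j hj ↦ ?_)
      (sup_span_singleton_le_annihilator_quotSMulTop hN y))
    have := hk j (by lia)
    have := hk (j + 1) (by lia)
    exact subsingleton_postcomp_right (f := LinearMap.lsmul R N y) hreg
      (Submodule.mkQ_surjective _) (exact_lsmul_mkQ N y) j

/-- Injective dimension can be tested on the residue field. -/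
lemma ModExt.subsingleton_of_forall_residueField {d : ℕ}
    (hk : ∀ i > d, Subsingleton (ModExt R (ResidueField R) N i))
    (L : Type u) [AddCommGroup L] [Module R L] [Module.Finite R L] (i : ℕ) (hi : d < i) :
    Subsingleton (ModExt R L N i) := by
  suffices ∀ I : Ideal R, ∀ (L : Type u) [AddCommGroup L] [Module R L] [Module.Finite R L],
      I ≤ Module.annihilator R L → ∀ i > d, Subsingleton (ModExt R L N i) from
    this ⊥ L bot_le i hi
  intro I
  induction I using IsNoetherian.induction with
  | hgt I ih =>
    intro L _ _ _ hL i hi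
    refine subsingleton_of_forall_prime (fun p hp hIp ↦ ?_) L hL
    by_cases hpm : p = maximalIdeal R
    · rw [hpm]
      exact hk i hi
    · obtain ⟨y, hy, hyp⟩ := SetLike.exists_of_lt ((le_maximalIdeal hp.ne_top).lt_of_ne hpm)
      have hlt : I < p ⊔ Ideal.span {y} := by
        refine hIp.trans_lt (left_lt_sup.mpr ?_)
        rwa [Ideal.span_singleton_le_iff_mem]
      have := ih _ hlt (QuotSMulTop y (R ⧸ p))
        (sup_span_singleton_le_annihilator_quotSMulTop (le_annihilator_quotient p) y)
        (i + 1) (by lia)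
      exact subsingleton_of_quotSMulTop hy (isSMulRegular_quotient_of_notMem hp hyp) i

lemma ModExt.subsingleton_of_isWeaklyRegular {d : ℕ}
    (hk : ∀ i > d, Subsingleton (ModExt R (ResidueField R) N i)) (rs : List R)
    (hrs : ∀ y ∈ rs, y ∈ maximalIdeal R)
    (A : Type u) [AddCommGroup A] [Module R A] [Module.Finite R A] (hA : IsWeaklyRegular A rs)
    (i : ℕ) (hi : d < i + rs.length) : Subsingleton (ModExt R A N i) := by
  induction rs generalizing A i with
  | nil => exact subsingleton_of_forall_residueField hk A i hi
  | cons y rs ih =>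
    rw [List.forall_mem_cons] at hrs
    rw [isWeaklyRegular_cons_iff] at hA
    have := ih hrs.2 (QuotSMulTop y A) hA.2 (i + 1) (by rw [List.length_cons] at hi; lia)
    exact subsingleton_of_quotSMulTop hrs.1 hA.1 i

omit [IsNoetherianRing R] [IsLocalRing R] [Module.Finite R N] in
/-- Rees' isomorphism, on the level of lengths. -/
lemma ModExt.length_quotient_ofList_smul_top (L : Type u) [AddCommGroup L] [Module R L]
    (ys : List R) (hys : ∀ y ∈ ys, y ∈ Module.annihilator R L) (hN : IsWeaklyRegular N ys) (i : ℕ)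
    (hL : ∀ j < i + ys.length, Subsingleton (ModExt R L N j)) :
    Module.length R (ModExt R L (N ⧸ (Ideal.ofList ys • ⊤ : Submodule R N)) i) =
      Module.length R (ModExt R L N (i + ys.length)) := by
  induction ys generalizing N with
  | nil =>
    have h0 : (Ideal.ofList ([] : List R) • ⊤ : Submodule R N) = ⊥ := by simp
    exact (postcompEquiv (Submodule.quotEquivOfEqBot _ h0) L i).length_eq
  | cons y ys ih =>
    rw [List.forall_mem_cons] at hys
    rw [List.length_cons] at hL ⊢
    rw [isWeaklyRegular_cons_iff] at hN
    have hex := exact_lsmul_mkQ N y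
    rw [(postcompEquiv (Submodule.quotOfListConsSMulTopEquivQuotSMulTopInner N y ys) L i).length_eq,
      ih hys.2 hN.2 fun j hj ↦ ?_]
    · have := hL (i + ys.length) (by lia)
      refine length_postcomp_shift (f := LinearMap.lsmul R N y) hN.1
        (Submodule.mkQ_surjective _) hex _ fun z ↦ ?_
      rw [postcomp_lsmul, smul_eq_zero_of_mem_annihilator hys.1]
    · have := hL j (by lia)
      have := hL (j + 1) (by lia)
      exact subsingleton_postcomp_right (f := LinearMap.lsmul R N y) hN.1
        (Submodule.mkQ_surjective _) hex j

end Vanishing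

section HilbertFunction

open RingTheory.Sequence ModExt
open scoped Pointwise

variable {R : Type u} [CommRing R]

lemma Ideal.sup_pow_succ (I J : Ideal R) (n : ℕ) :
    (I ⊔ J) ^ (n + 1) = I * (I ⊔ J) ^ n ⊔ J ^ (n + 1) := by
  induction n with
  | zero => simp
  | succ n ih =>
    have hle : J * (I * (I ⊔ J) ^ n) ≤ I * (I ⊔ J) ^ (n + 1) := by
      rw [pow_succ' (I ⊔ J) n, mul_left_comm]
      exact Ideal.mul_mono_right (Ideal.mul_mono_left le_sup_right)
    rw [pow_succ' _ (n + 1), Ideal.sup_mul]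
    rw [congrArg (J * ·) ih]
    rw [Ideal.mul_sup, ← pow_succ' J, ← sup_assoc, sup_eq_left.mpr hle]

variable {N : Type u} [AddCommGroup N] [Module R N]

lemma subsingleton_quotient_pow_zero_smul_top (I : Ideal R) :
    Subsingleton (N ⧸ (I ^ 0 • ⊤ : Submodule R N)) := by
  rw [pow_zero, Ideal.one_eq_top, Submodule.top_smul]
  infer_instance

/-- The exact sequence `0 → N ⧸ Jⁿ N → N ⧸ Jⁿ⁺¹ N → N' ⧸ Iⁿ⁺¹ N' → 0` with `J = (y) + I` and
`N' = N ⧸ y N`. -/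
lemma exists_exact_quotient_pow (I : Ideal R) (y : R) (n : ℕ)
    (hreg : IsSMulRegular (N ⧸ (I ^ (n + 1) • ⊤ : Submodule R N)) y) :
    ∃ (f : (N ⧸ ((Ideal.span {y} ⊔ I) ^ n • ⊤ : Submodule R N)) →ₗ[R]
          N ⧸ ((Ideal.span {y} ⊔ I) ^ (n + 1) • ⊤ : Submodule R N))
      (g : (N ⧸ ((Ideal.span {y} ⊔ I) ^ (n + 1) • ⊤ : Submodule R N)) →ₗ[R]
          QuotSMulTop y N ⧸ (I ^ (n + 1) • ⊤ : Submodule R (QuotSMulTop y N))),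
      Function.Injective f ∧ Function.Surjective g ∧ Function.Exact f g := by
  set J := Ideal.span {y} ⊔ I with hJ
  have hsucc : (J ^ (n + 1) • ⊤ : Submodule R N) = y • (J ^ n • ⊤) ⊔ I ^ (n + 1) • ⊤ := by
    rw [hJ, Ideal.sup_pow_succ, Submodule.sup_smul, Submodule.mul_smul,
      Submodule.ideal_span_singleton_smul]
  have hI : (I ^ (n + 1) • ⊤ : Submodule R N) ≤ J ^ n • ⊤ :=
    Submodule.smul_mono_left ((Ideal.pow_le_pow_right n.le_succ).trans
      (Ideal.pow_right_mono le_sup_right n))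
  have hle : (y • (J ^ n • ⊤) ⊔ I ^ (n + 1) • ⊤ : Submodule R N) ≤ y • ⊤ ⊔ I ^ (n + 1) • ⊤ :=
    sup_le_sup_right (smul_mono_right y le_top) _
  have hcomap : (I ^ (n + 1) • ⊤ : Submodule R (QuotSMulTop y N)).comap
      (y • (⊤ : Submodule R N)).mkQ = y • ⊤ ⊔ I ^ (n + 1) • ⊤ := by
    rw [← Submodule.range_mkQ, ← Submodule.map_top, ← Submodule.map_smul'',
      Submodule.comap_map_mkQ]
  refine ⟨Submodule.mapQ _ _ (LinearMap.lsmul R N y) ?_,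
    Submodule.mapQ _ _ (y • (⊤ : Submodule R N)).mkQ ?_, ?_, ?_, ?_⟩
  · intro z hz
    rw [hsucc]
    exact Submodule.mem_sup_left (Submodule.smul_mem_pointwise_smul _ _ _ hz)
  · rw [hcomap, hsucc]
    exact hle
  · rw [← LinearMap.ker_eq_bot, LinearMap.ker_eq_bot']
    intro a ha
    obtain ⟨z, rfl⟩ := Submodule.mkQ_surjective _ a
    simp only [Submodule.mkQ_apply, Submodule.mapQ_apply, LinearMap.lsmul_apply,
      Submodule.Quotient.mk_eq_zero, hsucc] at ha ⊢
    obtain ⟨_, hw, v, hv, hwv⟩ := Submodule.mem_sup.mp ha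
    obtain ⟨w, hw', rfl⟩ := Submodule.mem_smul_pointwise_iff_exists _ _ _ |>.mp hw
    have hzw : z - w ∈ (I ^ (n + 1) • ⊤ : Submodule R N) := by
      rw [← Submodule.Quotient.mk_eq_zero]
      refine hreg.right_eq_zero_of_smul ?_
      rw [← Submodule.Quotient.mk_smul, Submodule.Quotient.mk_eq_zero, smul_sub, ← hwv,
        add_sub_cancel_left]
      exact hv
    simpa using add_mem (hI hzw) hw'
  · rw [← LinearMap.range_eq_top, Submodule.range_mapQ]
    simp
  · intro a
    obtain ⟨z, rfl⟩ := Submodule.mkQ_surjective _ a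
    rw [Submodule.mkQ_apply, Submodule.mapQ_apply, Submodule.Quotient.mk_eq_zero,
      ← Submodule.mem_comap, hcomap]
    constructor
    · intro hz
      obtain ⟨_, hw, v, hv, rfl⟩ := Submodule.mem_sup.mp hz
      obtain ⟨w, -, rfl⟩ := Submodule.mem_smul_pointwise_iff_exists _ _ _ |>.mp hw
      refine ⟨Submodule.Quotient.mk w, ?_⟩
      rw [Submodule.mapQ_apply, Submodule.Quotient.eq, LinearMap.lsmul_apply, sub_add_cancel_left,
        neg_mem_iff, hsucc]
      exact Submodule.mem_sup_right hv
    · rintro ⟨a, ha⟩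
      obtain ⟨w, rfl⟩ := Submodule.mkQ_surjective _ a
      rw [Submodule.mkQ_apply, Submodule.mapQ_apply, Submodule.Quotient.eq, hsucc,
        LinearMap.lsmul_apply] at ha
      have hy : y • w ∈ (y • ⊤ ⊔ I ^ (n + 1) • ⊤ : Submodule R N) :=
        Submodule.mem_sup_left (Submodule.smul_mem_pointwise_smul _ _ _ trivial)
      rw [← Submodule.sub_mem_iff_left _ hy, ← neg_mem_iff, neg_sub]
      exact hle ha

variable [IsNoetherianRing R] [IsLocalRing R]

lemma isSMulRegular_quotient_pow_ofList [Module.Finite R N] (y : R) (ys : List R)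
    (hys : ∀ z ∈ y :: ys, z ∈ maximalIdeal R) (hN : IsWeaklyRegular N (y :: ys)) (n : ℕ) :
    IsSMulRegular (N ⧸ (Ideal.ofList ys ^ n • ⊤ : Submodule R N)) y := by
  induction ys generalizing N y n with
  | nil =>
    rw [isWeaklyRegular_cons_iff] at hN
    cases n with
    | zero =>
      have := subsingleton_quotient_pow_zero_smul_top (N := N) (Ideal.ofList ([] : List R))
      exact Function.injective_of_subsingleton _
    | succ n =>
      have h0 : (Ideal.ofList ([] : List R) ^ (n + 1) • ⊤ : Submodule R N) = ⊥ := by simp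
      exact ((Submodule.quotEquivOfEqBot _ h0).isSMulRegular_congr y).mpr hN.1
  | cons z zs ih =>
    have hperm₁ : (y :: z :: zs).Perm (z :: y :: zs) := .swap _ _ _
    have hperm₂ : (y :: z :: zs).Perm ((z :: zs) ++ [y]) := List.perm_append_singleton _ _ |>.symm
    have hN₁ := IsLocalRing.isWeaklyRegular_of_perm_of_subset_maximalIdeal hN hperm₁ hys
    have hN₂ := IsLocalRing.isWeaklyRegular_of_perm_of_subset_maximalIdeal hN hperm₂ hys
    rw [isWeaklyRegular_cons_iff] at hN₁
    rw [isWeaklyRegular_append_iff] at hN₂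
    rw [List.forall_mem_cons] at hys
    have hz := ih z hys.2 hN₂.1
    have hy := ih y (List.forall_mem_cons.mpr ⟨hys.1, (List.forall_mem_cons.mp hys.2).2⟩) hN₁.2
    rw [Ideal.ofList_cons]
    induction n with
    | zero =>
      have := subsingleton_quotient_pow_zero_smul_top (N := N)
        (Ideal.span {z} ⊔ Ideal.ofList zs)
      exact Function.injective_of_subsingleton _
    | succ n ihn =>
      obtain ⟨f, g, hf, -, h⟩ := exists_exact_quotient_pow (Ideal.ofList zs) z n (hz (n + 1))
      exact isSMulRegular_of_range_eq_ker hf h.linearMap_ker_eq.symm ihn (hy (n + 1))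

omit [IsNoetherianRing R] [IsLocalRing R] in
lemma ModExt.length_quotient_congr {M : Type u} [AddCommGroup M] [Module R M]
    {P Q : Submodule R N} (h : P = Q) (i : ℕ) :
    Module.length R (ModExt R M (N ⧸ P) i) = Module.length R (ModExt R M (N ⧸ Q) i) := by
  rw [h]

lemma ModExt.hilbert_function {M : Type u} [AddCommGroup M] [Module R M] [Module.Finite R N]
    (ys : List R) (hys : ∀ z ∈ ys, z ∈ maximalIdeal R) (hN : IsWeaklyRegular N ys)
    (hM : ∀ i ≥ 1, Subsingleton (ModExt R M N i)) (n : ℕ) :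
    (∀ i ≥ 1, Subsingleton (ModExt R M (N ⧸ (Ideal.ofList ys ^ n • ⊤ : Submodule R N)) i)) ∧
      Module.length R (ModExt R M (N ⧸ (Ideal.ofList ys ^ (n + 1) • ⊤ : Submodule R N)) 0) =
        (n + ys.length).choose ys.length •
          Module.length R (ModExt R M (N ⧸ (Ideal.ofList ys • ⊤ : Submodule R N)) 0) := by
  induction ys generalizing N n with
  | nil =>
    constructor
    · intro i hi
      cases n with
      | zero =>
        have := subsingleton_quotient_pow_zero_smul_top (N := N) (Ideal.ofList ([] : List R))
        exact subsingleton_of_subsingleton_right i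
      | succ n =>
        have h0 : (Ideal.ofList ([] : List R) ^ (n + 1) • ⊤ : Submodule R N) = ⊥ := by simp
        have := hM i hi
        exact (postcompEquiv (Submodule.quotEquivOfEqBot _ h0) M i).subsingleton
    · rw [List.length_nil, Nat.choose_zero_right, one_smul]
      exact length_quotient_congr (by simp) 0
  | cons y ys ih =>
    have hreg := isSMulRegular_quotient_pow_ofList y ys hys hN
    rw [isWeaklyRegular_cons_iff] at hN
    rw [List.forall_mem_cons] at hys
    have ih := ih hys.2 hN.2 fun i hi ↦ by
      have := hM i hi
      have := hM (i + 1) (by lia)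
      exact subsingleton_postcomp_right (f := LinearMap.lsmul R N y) hN.1
        (Submodule.mkQ_surjective _) (exact_lsmul_mkQ N y) i
    rw [Ideal.ofList_cons, List.length_cons]
    have hvan (n : ℕ) : ∀ i ≥ 1, Subsingleton
        (ModExt R M (N ⧸ ((Ideal.span {y} ⊔ Ideal.ofList ys) ^ n • ⊤ : Submodule R N)) i) := by
      intro i hi
      induction n with
      | zero =>
        have := subsingleton_quotient_pow_zero_smul_top (N := N)
          (Ideal.span {y} ⊔ Ideal.ofList ys)
        exact subsingleton_of_subsingleton_right i
      | succ n ihn =>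
        obtain ⟨f, g, hf, hg, h⟩ := exists_exact_quotient_pow (Ideal.ofList ys) y n (hreg (n + 1))
        have := (ih (n + 1)).1 i hi
        exact subsingleton_postcomp_middle hf hg h i
    have hlen (n : ℕ) : Module.length R (ModExt R M
          (N ⧸ ((Ideal.span {y} ⊔ Ideal.ofList ys) ^ (n + 1) • ⊤ : Submodule R N)) 0) =
        Module.length R (ModExt R M
          (N ⧸ ((Ideal.span {y} ⊔ Ideal.ofList ys) ^ n • ⊤ : Submodule R N)) 0) +
        (n + ys.length).choose ys.length • Module.length R (ModExt R M
          (QuotSMulTop y N ⧸ (Ideal.ofList ys • ⊤ : Submodule R (QuotSMulTop y N))) 0) := by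
      obtain ⟨f, g, hf, hg, h⟩ := exists_exact_quotient_pow (Ideal.ofList ys) y n (hreg (n + 1))
      have := hvan n 1 le_rfl
      rw [length_postcomp_middle hf hg h, (ih n).2]
    have hone : Module.length R (ModExt R M
          (N ⧸ ((Ideal.span {y} ⊔ Ideal.ofList ys) • ⊤ : Submodule R N)) 0) =
        Module.length R (ModExt R M
          (QuotSMulTop y N ⧸ (Ideal.ofList ys • ⊤ : Submodule R (QuotSMulTop y N))) 0) := by
      have := subsingleton_quotient_pow_zero_smul_top (N := N) (Ideal.span {y} ⊔ Ideal.ofList ys)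
      have := subsingleton_of_subsingleton_right (R := R) (N := M)
        (A := N ⧸ ((Ideal.span {y} ⊔ Ideal.ofList ys) ^ 0 • ⊤ : Submodule R N)) 0
      have h0 := hlen 0
      rw [Module.length_eq_zero (M := ModExt R M
          (N ⧸ ((Ideal.span {y} ⊔ Ideal.ofList ys) ^ 0 • ⊤ : Submodule R N)) 0),
        zero_add, zero_add, zero_add, Nat.choose_self, one_smul] at h0
      rw [← h0]
      exact length_quotient_congr (by rw [pow_one]) 0
    refine ⟨hvan n, ?_⟩
    induction n with
    | zero =>
      rw [zero_add, zero_add, Nat.choose_self, one_smul]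
      exact length_quotient_congr (by rw [pow_one]) 0
    | succ n ihn =>
      rw [hlen, ihn, hone, ← add_smul]
      congr 1
      rw [show n + 1 + (ys.length + 1) = n + 1 + ys.length + 1 by lia, Nat.choose_succ_succ',
        show n + (ys.length + 1) = n + 1 + ys.length by lia, add_comm]

end HilbertFunction

section CanonicalModule

open RingTheory.Sequence ModExt

variable {R : Type u} [CommRing R]

lemma Ideal.le_annihilator_quotient_smul_top (J : Ideal R) (L : Type u) [AddCommGroup L]
    [Module R L] : J ≤ Module.annihilator R (L ⧸ (J • ⊤ : Submodule R L)) := by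
  intro r hr
  rw [Module.mem_annihilator]
  intro a
  obtain ⟨z, rfl⟩ := Submodule.mkQ_surjective _ a
  rw [Submodule.mkQ_apply, ← Submodule.Quotient.mk_smul, Submodule.Quotient.mk_eq_zero]
  exact Submodule.smul_mem_smul hr trivial

lemma lcomp_mkQ_smul_top_bijective {J : Ideal R} {L Q : Type u} [AddCommGroup L] [Module R L]
    [AddCommGroup Q] [Module R Q] (hJ : J ≤ Module.annihilator R Q) :
    Function.Bijective (LinearMap.lcomp R Q (J • ⊤ : Submodule R L).mkQ) := by
  refine ⟨fun f g h ↦ LinearMap.cancel_right (Submodule.mkQ_surjective _) |>.mp h, fun f ↦ ?_⟩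
  have hf : (J • ⊤ : Submodule R L) ≤ f.ker := Submodule.smul_le.mpr fun r hr z _ ↦ by
    rw [LinearMap.mem_ker, map_smul]
    exact Module.mem_annihilator.mp (hJ hr) _
  exact ⟨Submodule.liftQ _ f hf, Submodule.liftQ_mkQ _ f hf⟩

variable [IsNoetherianRing R] [IsLocalRing R]

/-- The length of `Hom(M, N ⧸ Jⁿ⁺¹ N)` for `J` generated by a system of parameters of length `r`
when the only non-vanishing `Ext` of the residue field with values in `N` is
`Ext r k N ≃ k`. -/
theorem length_linearMap_quotient_pow {N : Type u} [AddCommGroup N] [Module R N]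
    [Module.Finite R N] (ys : List R) (hys : ∀ y ∈ ys, y ∈ maximalIdeal R) {k : ℕ}
    (hk : maximalIdeal R ^ k ≤ Ideal.ofList ys)
    (e : ModExt R (ResidueField R) N ys.length ≃ₗ[R] ResidueField R)
    (hne : ∀ i ≠ ys.length, Subsingleton (ModExt R (ResidueField R) N i))
    (M : Type u) [AddCommGroup M] [Module R M] [Module.Finite R M]
    (hM : ∀ i ≥ 1, Subsingleton (ModExt R M N i)) (n : ℕ) :
    Module.length R (M →ₗ[R] N ⧸ (Ideal.ofList ys ^ (n + 1) • ⊤ : Submodule R N)) =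
      (n + ys.length).choose ys.length •
        Module.length R (M ⧸ (Ideal.ofList ys • ⊤ : Submodule R M)) := by
  have hN : IsWeaklyRegular N ys := isWeaklyRegular_of_ext_residueField ys hys ⊥
    (by rwa [bot_sup_eq]) (fun j hj ↦ hne j hj.ne) bot_le
  set Q := N ⧸ (Ideal.ofList ys • ⊤ : Submodule R N)
  set L := M ⧸ (Ideal.ofList ys • ⊤ : Submodule R M)
  have hL := Ideal.le_annihilator_quotient_smul_top (Ideal.ofList ys) M
  have hLQ : Module.length R (ModExt R L Q 0) = Module.length R (ModExt R L N ys.length) := by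
    have h := length_quotient_ofList_smul_top L ys
      (fun y hy ↦ hL (Ideal.subset_span hy)) hN 0 fun j hj ↦ by
        have := hne j (by lia)
        exact subsingleton_of_maximalIdeal_pow_le L (hk.trans hL)
    rwa [zero_add] at h
  have := hne (ys.length + 1) (by lia)
  rw [← (equivHom M _).length_eq, (ModExt.hilbert_function ys hys hN hM n).2,
    (equivHom M Q).length_eq,
    ← (LinearEquiv.ofBijective _ (lcomp_mkQ_smul_top_bijective
      (Ideal.le_annihilator_quotient_smul_top (Ideal.ofList ys) N))).length_eq,
    ← (equivHom L Q).length_eq, hLQ,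
    length_of_maximalIdeal_pow_le (fun j hj ↦ hne j (by lia)) e L (hk.trans hL)]

end CanonicalModule

/-!
STATEMENT 3: `R` CM local of dimension `d` with canonical module `ω`, `M` maximal
Cohen-Macaulay and `J = (x₁,…,x_d)` a parameter ideal.  Then for all `n ≥ 0`,
`ℓ(Hom_R(M, ω/J^{n+1}ω)) = ℓ(M/JM)·C(n+d,d)`.
-/
theorem dual_hilbert_samuel_stmt_3
    (R : Type) [CommRing R] [IsLocalRing R] [IsNoetherianRing R]
    (d : ℕ) (hd : ringKrullDim R = d) (hCM : IsCMLocalRing R)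
    (ω : Type) [AddCommGroup ω] [Module R ω] (hω : IsCanonicalModule R d ω)
    (M : Type) [AddCommGroup M] [Module R M] [Module.Finite R M] (hM : IsMCM R M)
    (x : Fin d → R) (hx : ∀ j, x j ∈ maximalIdeal R)
    (J : Ideal R) (hJ : J = Ideal.span (Set.range x))
    (hJprim : J.radical = maximalIdeal R) (n : ℕ) :
    len R (M →ₗ[R] ω ⧸ (J ^ (n + 1) • ⊤ : Submodule R ω)) =
      ((n + d).choose d) • len R (M ⧸ (J • ⊤ : Submodule R M)) := by
  obtain ⟨_, ⟨e⟩, hne⟩ := hω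
  obtain ⟨rs, hrs, hlen, hreg⟩ := hM
  have hcomp (i : ℕ) : Nonempty (ModExt R (ResidueField R) ω i ≃ₗ[R] ExtM R i (ResidueField R) ω) :=
    (projectiveResolution (ModuleCat.of R (ResidueField R))).nonempty_ext_linearEquiv _ i
  have hne' (i : ℕ) (hi : i ≠ d) : Subsingleton (ModExt R (ResidueField R) ω i) :=
    have := hne i hi
    (hcomp i).some.subsingleton
  have hrsd : rs.length = d := by
    rw [hd] at hlen
    exact_mod_cast hlen
  have hvan (i : ℕ) (hi : i ≥ 1) : Subsingleton (ModExt R M ω i) :=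
    ModExt.subsingleton_of_isWeaklyRegular (d := d) (fun i hi ↦ hne' i hi.ne') rs hrs M
      hreg.toIsWeaklyRegular i (by lia)
  have hJx : J = Ideal.ofList (List.ofFn x) := by
    rw [hJ, Ideal.ofList]
    congr 1
    ext y
    simp
  obtain ⟨k, hk⟩ := Ideal.exists_radical_pow_le_of_fg J (IsNoetherian.noetherian _)
  rw [hJprim, hJx] at hk
  have hxd : (List.ofFn x).length = d := List.length_ofFn
  have h := length_linearMap_quotient_pow (N := ω) (List.ofFn x)
    (fun y hy ↦ by
      obtain ⟨j, rfl⟩ := List.mem_ofFn.mp hy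
      exact hx j)
    hk (by rw [hxd]; exact (hcomp d).some.trans e) (by rwa [hxd]) M hvan n
  rw [hxd, ← hJx] at h
  rw [len, len, ← Module.coe_length, ← Module.coe_length, h, WithBot.coe_nsmul]
end

section
/- Let R be a Noetherian local ring, I an ideal, M a finitely generated R-module, and x ∈ I \ I² such that x* is G_I(R)-regular. Set R' = R/(x), I' = I/(x), M' = M/xM. Then for all j ≥ 0 and n ≥ 1, ℓ(Ext^j_{R'}(M', R'/I'^{n+1})) ≤ ℓ(Ext^j_R(M, R/I^{n+1})) + ℓ(Ext^{j+1}_R(M, R/I^n)), provided these lengths are finite (e.g. when I is m-primary). -/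
open CategoryTheory IsLocalRing

theorem Module.length_le_add_of_exact {R A B C : Type*} [Ring R] [AddCommGroup A] [Module R A]
    [AddCommGroup B] [Module R B] [AddCommGroup C] [Module R C] (f : A →ₗ[R] B) (g : B →ₗ[R] C)
    (h : Function.Exact f g) :
    Module.length R B ≤ Module.length R A + Module.length R C := by
  have hex : Function.Exact (LinearMap.range f).subtype g.rangeRestrict := by
    rw [LinearMap.exact_iff, LinearMap.ker_rangeRestrict, Submodule.range_subtype,
      LinearMap.exact_iff.mp h]
  rw [Module.length_eq_add_of_exact _ _ (Submodule.subtype_injective _)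
    g.surjective_rangeRestrict hex]
  exact add_le_add (Module.length_le_of_surjective _ f.surjective_rangeRestrict)
    (Module.length_le_of_injective _ (Submodule.subtype_injective _))

/-- Postcomposition with `f` on the cochain complexes of morphisms out of `K`. -/
noncomputable def ChainComplex.linearYonedaObjMap {R : Type} [CommRing R]
    (K : ChainComplex (ModuleCat R) ℕ) {Y Z : ModuleCat R} (f : Y ⟶ Z) :
    K.linearYonedaObj R Y ⟶ K.linearYonedaObj R Z where
  f i := ModuleCat.ofHom (Linear.rightComp R (K.X i) f)
  comm' i j _ := by
    ext g
    exact (Category.assoc (K.d j i) (show K.X i ⟶ Y from g) f).symm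

theorem length_ext_le_of_shortExact {R : Type} [CommRing R] (X : ModuleCat R)
    (S : ShortComplex (ModuleCat R)) (hS : S.ShortExact) (j : ℕ) :
    Module.length R (((Ext R (ModuleCat R) j).obj (Opposite.op X)).obj S.X₃) ≤
      Module.length R (((Ext R (ModuleCat R) j).obj (Opposite.op X)).obj S.X₂) +
      Module.length R (((Ext R (ModuleCat R) (j + 1)).obj (Opposite.op X)).obj S.X₁) := by
  have hcomp {W : ModuleCat R} (g : W ⟶ S.X₁) : (g ≫ S.f) ≫ S.g = 0 := by simp
  have P : ProjectiveResolution X := (HasProjectiveResolution.out (Z := X)).some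
  let T : ShortComplex (CochainComplex (ModuleCat R) ℕ) :=
    .mk (P.complex.linearYonedaObjMap S.f) (P.complex.linearYonedaObjMap S.g) (by
      ext i g
      exact hcomp g)
  have hT : T.ShortExact := by
    refine HomologicalComplex.shortExact_of_degreewise_shortExact _ fun i => ?_
    have := hS.mono_f
    have := hS.epi_g
    refine ModuleCat.shortComplex_shortExact _ (fun g => ⟨fun hg => ?_, ?_⟩) ?_ fun g => ?_
    · exact ⟨hS.exact.lift g hg, hS.exact.lift_f g hg⟩
    · rintro ⟨g, rfl⟩
      exact hcomp g
    · intro a b h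
      exact (cancel_mono S.f).mp h
    · exact ⟨_, Projective.factorThru_comp (show P.complex.X i ⟶ S.X₃ from g) S.g⟩
  have hex := (ShortComplex.ShortExact.moduleCat_exact_iff_function_exact _).mp
    (hT.homology_exact₃ j (j + 1) rfl)
  rw [((P.isoExt j S.X₃).toLinearEquiv).length_eq, ((P.isoExt j S.X₂).toLinearEquiv).length_eq,
    ((P.isoExt (j + 1) S.X₁).toLinearEquiv).length_eq]
  exact Module.length_le_add_of_exact _ _ hex

/-- The `R ⧸ I`-linear map `M ⧸ I M → N ⧸ I N` induced by an `R`-linear map `M → N`. -/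
noncomputable def quotSMulMap {R M N : Type} [CommRing R] (I : Ideal R) [AddCommGroup M]
    [Module R M] [AddCommGroup N] [Module R N] (f : M →ₗ[R] N) :
    (M ⧸ (I • ⊤ : Submodule R M)) →ₗ[R ⧸ I] (N ⧸ (I • ⊤ : Submodule R N)) :=
  LinearMap.extendScalarsOfSurjective (R := R) (S := R ⧸ I) Ideal.Quotient.mk_surjective
    (Submodule.mapQ (I • ⊤ : Submodule R M) (I • ⊤ : Submodule R N) f
      (Submodule.smul_top_le_comap_smul_top I f))

theorem quotSMulMap_mk {R M N : Type} [CommRing R] (I : Ideal R) [AddCommGroup M]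
    [Module R M] [AddCommGroup N] [Module R N] (f : M →ₗ[R] N) (m : M) :
    quotSMulMap I f (Submodule.Quotient.mk m) = Submodule.Quotient.mk (f m) :=
  rfl

/-- The functor sending `M` to the `R ⧸ I`-module `M ⧸ I M`. -/
noncomputable def quotSMulFunctor {R : Type} [CommRing R] (I : Ideal R) :
    ModuleCat R ⥤ ModuleCat (R ⧸ I) where
  obj M := ModuleCat.of (R ⧸ I) (M ⧸ (I • ⊤ : Submodule R M))
  map f := ModuleCat.ofHom (quotSMulMap I f.hom)
  map_id M := ModuleCat.hom_ext <| LinearMap.ext fun m =>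
    Submodule.Quotient.induction_on _ m fun _ => quotSMulMap_mk _ _ _
  map_comp f g := ModuleCat.hom_ext <| LinearMap.ext fun m =>
    Submodule.Quotient.induction_on _ m fun m =>
      (quotSMulMap_mk I (f ≫ g).hom m).trans (by
        simp only [ModuleCat.hom_comp, ModuleCat.hom_ofHom, LinearMap.comp_apply, quotSMulMap_mk])

instance {R : Type} [CommRing R] (I : Ideal R) : (quotSMulFunctor I).Additive where
  map_add := ModuleCat.hom_ext <| LinearMap.ext fun m =>
    Submodule.Quotient.induction_on _ m fun _ => rfl

theorem projective_quotSMulFunctor_obj {R : Type} [CommRing R] (I : Ideal R) (P : ModuleCat R)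
    [Projective P] : Projective ((quotSMulFunctor I).obj P) := by
  have : Module.Projective R P := P.projective_of_module_projective
  have : Module.Projective (R ⧸ I) (P ⧸ (I • ⊤ : Submodule R P)) :=
    .of_equiv ((TensorProduct.quotTensorEquivQuotSMul P I).extendScalarsOfSurjective
      (S := R ⧸ I) Ideal.Quotient.mk_surjective)
  exact (IsProjective.iff_projective _).mp this

theorem isSMulRegular_of_projective {R P : Type*} [CommRing R] [AddCommGroup P] [Module R P]
    [Module.Projective R P] {x : R} (hx : IsSMulRegular R x) : IsSMulRegular P x := by
  obtain ⟨s, hs⟩ := Module.projective_def.mp ‹Module.Projective R P›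
  refine IsSMulRegular.of_right_eq_zero_of_smul fun p hp => ?_
  have : s p = 0 := by
    ext i
    apply hx
    simpa using DFunLike.congr_fun (congrArg s hp) i
  simpa [this] using (hs p).symm

theorem function_exact_quotSMulMap {R A B C : Type} [CommRing R] (x : R) [AddCommGroup A]
    [Module R A] [AddCommGroup B] [Module R B] [AddCommGroup C] [Module R C]
    (f : A →ₗ[R] B) (g : B →ₗ[R] C) (hfg : Function.Exact f g)
    (h : ∀ (b : B) (c : C), g b = x • c → ∃ w, g w = c) :
    Function.Exact (quotSMulMap (Ideal.span {x}) f) (quotSMulMap (Ideal.span {x}) g) := by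
  intro b
  obtain ⟨b, rfl⟩ := Submodule.Quotient.mk_surjective _ b
  rw [quotSMulMap_mk]
  constructor
  · intro hb
    rw [Submodule.Quotient.mk_eq_zero, Submodule.ideal_span_singleton_smul,
      Submodule.mem_smul_pointwise_iff_exists] at hb
    obtain ⟨c, -, hc⟩ := hb
    obtain ⟨w, rfl⟩ := h b c hc.symm
    obtain ⟨a, ha⟩ := (hfg (b - x • w)).mp (by simp [hc])
    refine ⟨Submodule.Quotient.mk a, ?_⟩
    rw [quotSMulMap_mk, Submodule.Quotient.eq, ha, Submodule.ideal_span_singleton_smul,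
      Submodule.mem_smul_pointwise_iff_exists]
    exact ⟨-w, trivial, by simp⟩
  · rintro ⟨a, ha⟩
    obtain ⟨a, rfl⟩ := Submodule.Quotient.mk_surjective _ a
    rw [← quotSMulMap_mk, ← ha, quotSMulMap_mk, quotSMulMap_mk, hfg.apply_apply_eq_zero]
    rfl

/-- If `x` is regular on `R` and `M`, reducing a projective resolution of `M` modulo `x` gives a
projective resolution of `M ⧸ x M`. -/
noncomputable def CategoryTheory.ProjectiveResolution.quotSMul {R : Type} [CommRing R] {x : R}
    {M : ModuleCat R} (P : ProjectiveResolution M) (hxR : IsSMulRegular R x)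
    (hxM : IsSMulRegular M x) :
    ProjectiveResolution ((quotSMulFunctor (Ideal.span {x})).obj M) where
  complex := ((quotSMulFunctor (Ideal.span {x})).mapHomologicalComplex _).obj P.complex
  projective n := projective_quotSMulFunctor_obj _ _
  π := (ChainComplex.toSingle₀Equiv _ _).symm
    ⟨(quotSMulFunctor (Ideal.span {x})).map (P.π.f 0), by
      refine ((quotSMulFunctor (Ideal.span {x})).map_comp _ _).symm.trans ?_
      exact (congrArg _ P.complex_d_comp_π_f_zero).trans (Functor.map_zero _ _ _)⟩
  quasiIso := by
    have hreg (n : ℕ) : IsSMulRegular (P.complex.X n) x := by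
      have := (P.complex.X n).projective_of_module_projective
      exact isSMulRegular_of_projective hxR
    have hreg' : IsSMulRegular (((ChainComplex.single₀ (ModuleCat R)).obj M).X 0) x := hxM
    have hε : Function.Surjective (P.π.f 0) := (ModuleCat.epi_iff_surjective _).mp inferInstance
    have h₀ : Function.Exact (P.complex.d 1 0) (P.π.f 0) :=
      (ShortComplex.ShortExact.moduleCat_exact_iff_function_exact _).mp P.exact₀
    have hs (n : ℕ) : Function.Exact (P.complex.d (n + 2) (n + 1)) (P.complex.d (n + 1) n) :=
      (ShortComplex.ShortExact.moduleCat_exact_iff_function_exact _).mp (P.exact_succ n)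
    refine ⟨fun n => ?_⟩
    cases n with
    | zero =>
      rw [ChainComplex.quasiIsoAt₀_iff, ShortComplex.quasiIso_iff_of_zeros']
      · refine ⟨(ShortComplex.ShortExact.moduleCat_exact_iff_function_exact _).mpr ?_,
          (ModuleCat.epi_iff_surjective _).mpr ?_⟩
        · exact function_exact_quotSMulMap x (P.complex.d 1 0).hom (P.π.f 0).hom h₀ fun _ c _ => hε c
        · intro m
          obtain ⟨m, rfl⟩ := Submodule.Quotient.mk_surjective _ m
          obtain ⟨p, rfl⟩ := hε m
          exact ⟨Submodule.Quotient.mk p, rfl⟩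
      · exact (((quotSMulFunctor (Ideal.span {x})).mapHomologicalComplex _).obj P.complex).shape _ _
          (by simp)
      all_goals rfl
    | succ n =>
      rw [quasiIsoAt_iff_exactAt' _ _ (ChainComplex.exactAt_succ_single_obj _ _),
        HomologicalComplex.exactAt_iff' _ (n + 2) (n + 1) n (by simp only [ChainComplex.prev]; rfl)
          (by simp), ShortComplex.ShortExact.moduleCat_exact_iff_function_exact]
      refine function_exact_quotSMulMap x (P.complex.d (n + 2) (n + 1)).hom
        (P.complex.d (n + 1) n).hom (hs n) fun b c hbc => ?_
      cases n with
      | zero =>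
        refine (h₀ c).mp (hreg'.right_eq_zero_of_smul ?_)
        rw [← map_smul]
        exact (h₀ _).mpr ⟨b, hbc⟩
      | succ n =>
        refine (hs n c).mp ((hreg n).right_eq_zero_of_smul ?_)
        rw [← map_smul]
        exact (hs n _).mpr ⟨b, hbc⟩

/-- The `R ⧸ I`-linear map `M ⧸ I M → N` induced by an `R`-linear map `M → N` into an
`R ⧸ I`-module. -/
noncomputable def quotSMulLift {R M N : Type} [CommRing R] (I : Ideal R) [AddCommGroup M]
    [Module R M] [AddCommGroup N] [Module R N] [Module (R ⧸ I) N] [IsScalarTower R (R ⧸ I) N]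
    (f : M →ₗ[R] N) : (M ⧸ (I • ⊤ : Submodule R M)) →ₗ[R ⧸ I] N :=
  LinearMap.extendScalarsOfSurjective (R := R) (S := R ⧸ I) Ideal.Quotient.mk_surjective
    (Submodule.liftQ (I • ⊤ : Submodule R M) f (Submodule.smul_le.mpr fun r hr m _ => by
      rw [LinearMap.mem_ker, map_smul, ← one_smul (R ⧸ I) (f m), ← smul_assoc,
        Algebra.smul_def, Ideal.Quotient.algebraMap_eq, Ideal.Quotient.eq_zero_iff_mem.mpr hr]
      simp))

/-- Maps from `M ⧸ I M` to an `R ⧸ I`-module are the same as `R`-linear maps from `M`. -/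
noncomputable def quotSMulHomEquiv {R : Type} [CommRing R] (I : Ideal R)
    (M : ModuleCat R) (N : Type) [AddCommGroup N] [Module R N] [Module (R ⧸ I) N]
    [IsScalarTower R (R ⧸ I) N] :
    (ModuleCat.restrictScalars (Ideal.Quotient.mk I)).obj
      (ModuleCat.of (R ⧸ I) ((quotSMulFunctor I).obj M ⟶ ModuleCat.of (R ⧸ I) N)) ≃ₗ[R]
      (M ⟶ ModuleCat.of R N) where
  toFun f :=
    let f' : (M ⧸ (I • ⊤ : Submodule R M)) →ₗ[R ⧸ I] N :=
      (show (quotSMulFunctor I).obj M ⟶ ModuleCat.of (R ⧸ I) N from f).hom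
    ModuleCat.ofHom ((f'.restrictScalars R).comp (Submodule.mkQ (I • ⊤ : Submodule R M)))
  invFun f := show (quotSMulFunctor I).obj M ⟶ ModuleCat.of (R ⧸ I) N from
    ModuleCat.ofHom (quotSMulLift I f.hom)
  map_add' f g := rfl
  map_smul' r f := ModuleCat.hom_ext <| LinearMap.ext fun m => by
    let f' : (M ⧸ (I • ⊤ : Submodule R M)) →ₗ[R ⧸ I] N :=
      (show (quotSMulFunctor I).obj M ⟶ ModuleCat.of (R ⧸ I) N from f).hom
    change Ideal.Quotient.mk I r • f' (Submodule.Quotient.mk m) =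
      r • f' (Submodule.Quotient.mk m)
    exact algebraMap_smul (R ⧸ I) r _
  left_inv f := ModuleCat.hom_ext <| LinearMap.ext fun m =>
    Submodule.Quotient.induction_on _ m fun _ => rfl
  right_inv f := rfl

/-- The comparison of complexes computing `Ext` over `R ⧸ I` and over `R`. -/
noncomputable def linearYonedaObjQuotSMulIso {R : Type} [CommRing R] (I : Ideal R)
    (K : ChainComplex (ModuleCat R) ℕ) (N : Type) [AddCommGroup N] [Module R N]
    [Module (R ⧸ I) N] [IsScalarTower R (R ⧸ I) N] :
    ((ModuleCat.restrictScalars (Ideal.Quotient.mk I)).mapHomologicalComplex _).obj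
      (ChainComplex.linearYonedaObj (((quotSMulFunctor I).mapHomologicalComplex _).obj K) (R ⧸ I)
        (ModuleCat.of (R ⧸ I) N)) ≅
      K.linearYonedaObj R (ModuleCat.of R N) :=
  HomologicalComplex.Hom.isoOfComponents
    (fun i => (quotSMulHomEquiv I (K.X i) N).toModuleIso) (fun i j _ => by
      ext f
      rfl)

theorem length_restrictScalars_quotient {R : Type} [CommRing R] (I : Ideal R)
    (A : ModuleCat (R ⧸ I)) :
    Module.length (R ⧸ I) A =
      Module.length R ((ModuleCat.restrictScalars (Ideal.Quotient.mk I)).obj A) := by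
  let : Module R A := Module.compHom A (Ideal.Quotient.mk I)
  have : IsScalarTower R (R ⧸ I) A := .of_algebraMap_smul fun _ _ => rfl
  have h : Module.length R A = Module.length (R ⧸ I) A :=
    Module.length_eq_of_surjective Ideal.Quotient.mk_surjective
  exact h.symm

theorem length_ext_quotSMul {R : Type} [CommRing R] {x : R} (M : ModuleCat R)
    (hxR : IsSMulRegular R x) (hxM : IsSMulRegular M x) (N : Type) [AddCommGroup N] [Module R N]
    [Module (R ⧸ Ideal.span {x}) N] [IsScalarTower R (R ⧸ Ideal.span {x}) N] (j : ℕ) :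
    Module.length (R ⧸ Ideal.span {x})
      (((Ext (R ⧸ Ideal.span {x}) (ModuleCat (R ⧸ Ideal.span {x})) j).obj
        (Opposite.op ((quotSMulFunctor (Ideal.span {x})).obj M))).obj (ModuleCat.of _ N)) =
    Module.length R (((Ext R (ModuleCat R) j).obj (Opposite.op M)).obj (ModuleCat.of R N)) := by
  have P : ProjectiveResolution M := (HasProjectiveResolution.out (Z := M)).some
  let C := ((P.quotSMul hxR hxM).complex.linearYonedaObj (R ⧸ Ideal.span {x})
    (ModuleCat.of (R ⧸ Ideal.span {x}) N))
  let F := ModuleCat.restrictScalars (Ideal.Quotient.mk (Ideal.span {x}))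
  let e : F.obj (C.homology j) ≅
      (P.complex.linearYonedaObj R (ModuleCat.of R N)).homology j :=
    ((C.sc j).mapHomologyIso F).symm ≪≫ HomologicalComplex.homologyMapIso
      (linearYonedaObjQuotSMulIso (Ideal.span {x}) P.complex N) j
  rw [(((P.quotSMul hxR hxM).isoExt j (ModuleCat.of _ N)).toLinearEquiv).length_eq,
    ((P.isoExt j (ModuleCat.of R N)).toLinearEquiv).length_eq, ← e.toLinearEquiv.length_eq]
  exact length_restrictScalars_quotient _ _

theorem mem_pow_of_mul_mem_pow_succ {R : Type} [CommRing R] {I : Ideal R} {x : R}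
    (hreg : ∀ (n : ℕ) (r : R), r ∈ I ^ n → x * r ∈ I ^ (n + 2) → r ∈ I ^ (n + 1))
    {n : ℕ} {r : R} (hr : x * r ∈ I ^ (n + 1)) : r ∈ I ^ n := by
  have key : ∀ k ≤ n, r ∈ I ^ k := by
    intro k
    induction k with
    | zero => simp
    | succ k ih =>
      intro hk
      exact hreg k r (ih (by omega)) (Ideal.pow_le_pow_right (by omega) hr)
  exact key n le_rfl

/-- With `R' = R ⧸ (x)`, the short exact sequence
`0 → R ⧸ I ^ n → R ⧸ I ^ (n + 1) → R' ⧸ (I R') ^ (n + 1) → 0` whose first map is multiplication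
by `x`. -/
theorem exists_shortExact_quotient_pow {R : Type} [CommRing R] {I : Ideal R} {x : R} (hx : x ∈ I)
    (hreg : ∀ (n : ℕ) (r : R), r ∈ I ^ n → x * r ∈ I ^ (n + 2) → r ∈ I ^ (n + 1)) (n : ℕ) :
    ∃ S : ShortComplex (ModuleCat R), S.ShortExact ∧ S.X₁ = ModuleCat.of R (R ⧸ I ^ n) ∧
      S.X₂ = ModuleCat.of R (R ⧸ I ^ (n + 1)) ∧
      S.X₃ = ModuleCat.of R ((R ⧸ Ideal.span {x}) ⧸
        ((I.map (Ideal.Quotient.mk (Ideal.span {x}))) ^ (n + 1))) := by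
  have hφ (r : R) : Algebra.linearMap R ((R ⧸ Ideal.span {x}) ⧸
      ((I.map (Ideal.Quotient.mk (Ideal.span {x}))) ^ (n + 1))) r = 0 ↔
      ∃ s, x * s - r ∈ I ^ (n + 1) := by
    change Ideal.Quotient.mk _ (Ideal.Quotient.mk _ r) = 0 ↔ _
    rw [Ideal.Quotient.eq_zero_iff_mem, ← Ideal.map_pow, ← Ideal.mem_comap,
      Ideal.comap_map_of_surjective' _ Ideal.Quotient.mk_surjective, Ideal.mk_ker, Submodule.mem_sup]
    constructor
    · rintro ⟨y, hy, z, hz, rfl⟩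
      obtain ⟨s, rfl⟩ := Ideal.mem_span_singleton'.mp hz
      exact ⟨s, by simpa [mul_comm] using hy⟩
    · rintro ⟨s, hs⟩
      exact ⟨r - x * s, by simpa using neg_mem hs, x * s, Ideal.mul_mem_right _ _
        (Ideal.mem_span_singleton_self x), by ring⟩
  let f : (R ⧸ I ^ n) →ₗ[R] (R ⧸ I ^ (n + 1)) :=
    Submodule.mapQ (I ^ n) (I ^ (n + 1)) (LinearMap.mulLeft R x) fun r hr => by
      simpa [pow_succ'] using Ideal.mul_mem_mul hx hr
  let g : (R ⧸ I ^ (n + 1)) →ₗ[R] ((R ⧸ Ideal.span {x}) ⧸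
      ((I.map (Ideal.Quotient.mk (Ideal.span {x}))) ^ (n + 1))) :=
    Submodule.liftQ (I ^ (n + 1)) (Algebra.linearMap R _) fun r hr =>
      (hφ r).mpr ⟨0, by simpa using hr⟩
  have hf (r : R) : f (Submodule.Quotient.mk r) = Submodule.Quotient.mk (x * r) := rfl
  have hg (r : R) : g (Submodule.Quotient.mk r) = Algebra.linearMap R _ r := rfl
  have hfg : Function.Exact f g := fun r => by
    obtain ⟨r, rfl⟩ := Submodule.Quotient.mk_surjective _ r
    rw [hg, hφ]
    constructor
    · rintro ⟨s, hs⟩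
      exact ⟨Submodule.Quotient.mk s, (Submodule.Quotient.eq _).mpr hs⟩
    · rintro ⟨s, hs⟩
      obtain ⟨s, rfl⟩ := Submodule.Quotient.mk_surjective _ s
      exact ⟨s, (Submodule.Quotient.eq _).mp hs⟩
  have hfi : Function.Injective f := by
    refine (injective_iff_map_eq_zero f).mpr fun r hr => ?_
    obtain ⟨r, rfl⟩ := Submodule.Quotient.mk_surjective _ r
    rw [hf, Submodule.Quotient.mk_eq_zero] at hr
    exact (Submodule.Quotient.mk_eq_zero _).mpr (mem_pow_of_mul_mem_pow_succ hreg hr)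
  have hgs : Function.Surjective g := fun y => by
    obtain ⟨y, rfl⟩ := Ideal.Quotient.mk_surjective y
    obtain ⟨y, rfl⟩ := Ideal.Quotient.mk_surjective y
    exact ⟨Submodule.Quotient.mk y, rfl⟩
  exact ⟨ModuleCat.shortComplexOfCompEqZero f g hfg.linearMap_comp_eq_zero,
    ModuleCat.shortComplex_shortExact _ hfg hfi hgs, rfl, rfl, rfl⟩

/-!
STATEMENT 12: Let `R` be a Noetherian local ring, `I` an `m`-primary ideal, `M` a finitely
generated `R`-module, and `x ∈ I \ I²` (regular on `R` and `M`) whose initial form is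
`G_I(R)`-regular.  With `R' = R/(x)`, `I' = I/(x)`, `M' = M/xM`, for all `j ≥ 0`, `n ≥ 1`:
`ℓ(Ext^j_{R'}(M', R'/I'^{n+1})) ≤ ℓ(Ext^j_R(M, R/I^{n+1})) + ℓ(Ext^{j+1}_R(M, R/I^n))`.
-/
theorem dual_hilbert_samuel_stmt_12
    (R : Type) [CommRing R] [IsLocalRing R] [IsNoetherianRing R]
    (I : Ideal R) (hIne : I ≠ ⊤) (hIprim : I.radical = maximalIdeal R)
    (M : Type) [AddCommGroup M] [Module R M] [Module.Finite R M]
    (x : R) (hx : x ∈ I) (hx2 : x ∉ I ^ 2)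
    (hxR : IsSMulRegular R x) (hxM : IsSMulRegular M x)
    (hreg : ∀ (n : ℕ) (r : R), r ∈ I ^ n → x * r ∈ I ^ (n + 2) → r ∈ I ^ (n + 1))
    (j n : ℕ) (hn : 1 ≤ n) :
    len (R ⧸ Ideal.span {x})
        (ExtM (R ⧸ Ideal.span {x}) j (M ⧸ (Ideal.span {x} • ⊤ : Submodule R M))
          ((R ⧸ Ideal.span {x}) ⧸
            ((I.map (Ideal.Quotient.mk (Ideal.span {x}))) ^ (n + 1) :
              Ideal (R ⧸ Ideal.span {x})))) ≤
      len R (ExtM R j M (R ⧸ (I ^ (n + 1) : Ideal R))) +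
        len R (ExtM R (j + 1) M (R ⧸ (I ^ n : Ideal R))) := by
  obtain ⟨S, hS, h₁, h₂, h₃⟩ := exists_shortExact_quotient_pow hx hreg n
  have hle := length_ext_le_of_shortExact (ModuleCat.of R M) S hS j
  rw [h₁, h₂, h₃, ← length_ext_quotSMul (ModuleCat.of R M) hxR hxM _ j] at hle
  simp only [len, ← Module.coe_length]
  exact_mod_cast hle
end
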